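/- (Diewert's mean value theorem, decreasing direction) Let φ: [0,1] → ℝ be lower semicontinuous. Then there exists s ∈ (0,1] such that φ(0) − φ(1) ≤ φ↓(s, −1), where φ↓ denotes the lower Dini directional derivative. -/

import Mathlib

open Set Filter Topology

/-- Lower Dini directional derivative of a real-valued function on `ℝ`:
`liminf_{s → 0+} (φ (t + s d) - φ t) / s`, valued in `EReal`. -/
noncomputable def dini (φ : ℝ → ℝ) (t d : ℝ) : EReal :=
  Filter.liminf (fun s : ℝ => (((φ (t + s * d) - φ t) / s : ℝ) : EReal))
    (nhdsWithin 0 (Set.Ioi 0))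

theorem stmt_11 (φ : ℝ → ℝ) (hlsc : LowerSemicontinuousOn φ (Set.Icc (0 : ℝ) 1)) :
    ∃ s ∈ Set.Ioc (0 : ℝ) 1, ((φ 0 - φ 1 : ℝ) : EReal) ≤ dini φ s (-1) := by
  have hg : LowerSemicontinuousOn (fun t => φ t + t * (φ 0 - φ 1)) (Set.Icc (0 : ℝ) 1) :=
    hlsc.add ((Continuous.lowerSemicontinuous (by fun_prop)).lowerSemicontinuousOn _)
  obtain ⟨m, hm, hmin⟩ := hg.exists_isMinOn (nonempty_Icc.2 zero_le_one) isCompact_Icc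
  have key : ∃ s ∈ Set.Ioc (0 : ℝ) 1, ∀ t ∈ Set.Icc (0 : ℝ) 1,
      φ s + s * (φ 0 - φ 1) ≤ φ t + t * (φ 0 - φ 1) := by
    rcases hm.1.eq_or_lt with h | h
    · subst h
      refine ⟨1, by simp, fun t ht => ?_⟩
      have := isMinOn_iff.1 hmin t ht
      linarith
    · exact ⟨m, ⟨h, hm.2⟩, fun t ht => isMinOn_iff.1 hmin t ht⟩
  obtain ⟨s, hs, hs'⟩ := key
  refine ⟨s, hs, ?_⟩
  unfold dini
  refine Filter.le_liminf_of_le (by isBoundedDefault) ?_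
  filter_upwards [Ioo_mem_nhdsGT hs.1] with h hh
  rw [EReal.coe_le_coe_iff, le_div_iff₀ hh.1]
  have := hs' (s + h * (-1)) ⟨by linarith [hh.2], by linarith [hh.1, hs.2]⟩
  linarith
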